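/- Let g be an isometry of finite order of the lattice 𝐋 = 3U ⊕ 2E8 ⊕ A2 which acts trivially on the discriminant group 𝐋^♯, and such that the coinvariant sublattice 𝐋_g is negative definite and contains no vector of square -2 and no vector of square -4. Then g is the identity. -/

import Mathlib

open Matrix

/-- Gram matrix of the lattice `𝐋 = 3U ⊕ 2E8 ⊕ A2` (with `E8` negative definite):
three hyperbolic blocks, two copies of the negative definite `E8` Gram matrix,
and the `A2` block `!![-2,1;1,-2]`. -/
def LGram : Matrix (Fin 24) (Fin 24) ℤ :=
  !![0, 1, 0, 0, 0, 0, 0, 0, 0, 0, 0, 0, 0, 0, 0, 0, 0, 0, 0, 0, 0, 0, 0, 0;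
    1, 0, 0, 0, 0, 0, 0, 0, 0, 0, 0, 0, 0, 0, 0, 0, 0, 0, 0, 0, 0, 0, 0, 0;
    0, 0, 0, 1, 0, 0, 0, 0, 0, 0, 0, 0, 0, 0, 0, 0, 0, 0, 0, 0, 0, 0, 0, 0;
    0, 0, 1, 0, 0, 0, 0, 0, 0, 0, 0, 0, 0, 0, 0, 0, 0, 0, 0, 0, 0, 0, 0, 0;
    0, 0, 0, 0, 0, 1, 0, 0, 0, 0, 0, 0, 0, 0, 0, 0, 0, 0, 0, 0, 0, 0, 0, 0;
    0, 0, 0, 0, 1, 0, 0, 0, 0, 0, 0, 0, 0, 0, 0, 0, 0, 0, 0, 0, 0, 0, 0, 0;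
    0, 0, 0, 0, 0, 0, -2, 0, 1, 0, 0, 0, 0, 0, 0, 0, 0, 0, 0, 0, 0, 0, 0, 0;
    0, 0, 0, 0, 0, 0, 0, -2, 0, 1, 0, 0, 0, 0, 0, 0, 0, 0, 0, 0, 0, 0, 0, 0;
    0, 0, 0, 0, 0, 0, 1, 0, -2, 1, 0, 0, 0, 0, 0, 0, 0, 0, 0, 0, 0, 0, 0, 0;
    0, 0, 0, 0, 0, 0, 0, 1, 1, -2, 1, 0, 0, 0, 0, 0, 0, 0, 0, 0, 0, 0, 0, 0;
    0, 0, 0, 0, 0, 0, 0, 0, 0, 1, -2, 1, 0, 0, 0, 0, 0, 0, 0, 0, 0, 0, 0, 0;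
    0, 0, 0, 0, 0, 0, 0, 0, 0, 0, 1, -2, 1, 0, 0, 0, 0, 0, 0, 0, 0, 0, 0, 0;
    0, 0, 0, 0, 0, 0, 0, 0, 0, 0, 0, 1, -2, 1, 0, 0, 0, 0, 0, 0, 0, 0, 0, 0;
    0, 0, 0, 0, 0, 0, 0, 0, 0, 0, 0, 0, 1, -2, 0, 0, 0, 0, 0, 0, 0, 0, 0, 0;
    0, 0, 0, 0, 0, 0, 0, 0, 0, 0, 0, 0, 0, 0, -2, 0, 1, 0, 0, 0, 0, 0, 0, 0;
    0, 0, 0, 0, 0, 0, 0, 0, 0, 0, 0, 0, 0, 0, 0, -2, 0, 1, 0, 0, 0, 0, 0, 0;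
    0, 0, 0, 0, 0, 0, 0, 0, 0, 0, 0, 0, 0, 0, 1, 0, -2, 1, 0, 0, 0, 0, 0, 0;
    0, 0, 0, 0, 0, 0, 0, 0, 0, 0, 0, 0, 0, 0, 0, 1, 1, -2, 1, 0, 0, 0, 0, 0;
    0, 0, 0, 0, 0, 0, 0, 0, 0, 0, 0, 0, 0, 0, 0, 0, 0, 1, -2, 1, 0, 0, 0, 0;
    0, 0, 0, 0, 0, 0, 0, 0, 0, 0, 0, 0, 0, 0, 0, 0, 0, 0, 1, -2, 1, 0, 0, 0;
    0, 0, 0, 0, 0, 0, 0, 0, 0, 0, 0, 0, 0, 0, 0, 0, 0, 0, 0, 1, -2, 1, 0, 0;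
    0, 0, 0, 0, 0, 0, 0, 0, 0, 0, 0, 0, 0, 0, 0, 0, 0, 0, 0, 0, 1, -2, 0, 0;
    0, 0, 0, 0, 0, 0, 0, 0, 0, 0, 0, 0, 0, 0, 0, 0, 0, 0, 0, 0, 0, 0, -2, 1;
    0, 0, 0, 0, 0, 0, 0, 0, 0, 0, 0, 0, 0, 0, 0, 0, 0, 0, 0, 0, 0, 0, 1, -2]

/-- The bilinear form of the lattice `𝐋`. -/
def Bf (v w : Fin 24 → ℤ) : ℤ := v ⬝ᵥ (LGram *ᵥ w)

/-- An isometry of `𝐋` is a `ℤ`-linear automorphism preserving the bilinear form. -/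
def IsIsometry (g : (Fin 24 → ℤ) ≃ₗ[ℤ] (Fin 24 → ℤ)) : Prop :=
  ∀ v w, Bf (g v) (g w) = Bf v w

/-- The invariant sublattice `𝐋^g = {v ∈ 𝐋 : g v = v}`. -/
def invL (g : (Fin 24 → ℤ) ≃ₗ[ℤ] (Fin 24 → ℤ)) : Submodule ℤ (Fin 24 → ℤ) where
  carrier := {v | g v = v}
  add_mem' := by intro a b ha hb; simp only [Set.mem_setOf_eq, map_add] at *; rw [ha, hb]
  zero_mem' := by simp
  smul_mem' := by intro c a ha; simp only [Set.mem_setOf_eq, _root_.map_smul] at *; rw [ha]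

/-- The coinvariant sublattice `𝐋_g = {v ∈ 𝐋 : v·w = 0 for all w ∈ 𝐋^g}`. -/
def coinvL (g : (Fin 24 → ℤ) ≃ₗ[ℤ] (Fin 24 → ℤ)) : Submodule ℤ (Fin 24 → ℤ) where
  carrier := {v | ∀ w ∈ invL g, Bf v w = 0}
  add_mem' := by
    intro a b ha hb w hw
    simp only [Bf, add_dotProduct] at *
    rw [ha w hw, hb w hw, add_zero]
  zero_mem' := by intro w hw; simp [Bf]
  smul_mem' := by
    intro c a ha w hw
    simp only [Bf, smul_dotProduct] at *
    rw [ha w hw, smul_zero]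

/-- The divisibility of `v` in `𝐋` is `d`, i.e. `gcd {v·w : w ∈ 𝐋} = d`. -/
def HasDivisibility (v : Fin 24 → ℤ) (d : ℤ) : Prop :=
  (∀ w, d ∣ Bf v w) ∧ ∀ e : ℤ, (∀ w, e ∣ Bf v w) → e ∣ d

/-- The Gram matrix of `𝐋` over `ℚ`. -/
def QGram : Matrix (Fin 24) (Fin 24) ℚ := LGram.map (Int.cast)

/-- The bilinear form of `𝐋 ⊗ ℚ`. -/
def Bq (x y : Fin 24 → ℚ) : ℚ := x ⬝ᵥ (QGram *ᵥ y)

/-- The inclusion `𝐋 ⊆ 𝐋 ⊗ ℚ`. -/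
def intVec (w : Fin 24 → ℤ) : Fin 24 → ℚ := fun i => (w i : ℚ)

/-- `x ∈ 𝐋 ⊗ ℚ` lies in the dual lattice `𝐋^∨` iff it pairs integrally with `𝐋`. -/
def InDual (x : Fin 24 → ℚ) : Prop := ∀ w : Fin 24 → ℤ, ∃ n : ℤ, Bq x (intVec w) = (n : ℚ)

/-- `x ∈ 𝐋 ⊗ ℚ` lies in `𝐋` iff all its coordinates are integers. -/
def IsIntVec (x : Fin 24 → ℚ) : Prop := ∀ i, ∃ n : ℤ, x i = (n : ℚ)

/-- The matrix over `ℚ` of the rational extension of `g` to `𝐋 ⊗ ℚ`. -/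
def gQ (g : (Fin 24 → ℤ) ≃ₗ[ℤ] (Fin 24 → ℤ)) : Matrix (Fin 24) (Fin 24) ℚ :=
  (LinearMap.toMatrix' g.toLinearMap).map (Int.cast)

/-- `g` acts trivially on the discriminant group `𝐋^♯ = 𝐋^∨/𝐋`, i.e. the induced map
`g^♯` is the identity: `g(x) - x ∈ 𝐋` for every `x ∈ 𝐋^∨`. -/
def ActsTriviallyOnDisc (g : (Fin 24 → ℤ) ≃ₗ[ℤ] (Fin 24 → ℤ)) : Prop :=
  ∀ x : Fin 24 → ℚ, InDual x → IsIntVec (gQ g *ᵥ x - x)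


def nsq {n : ℕ} (x : Fin n → ℝ) : ℝ := ∑ k, (x k)^2

lemma weights_aux {n : ℕ} {ι : Type*} [DecidableEq ι] (t : Finset ι) (a : ι → Fin n → ℝ)
    (h : ∀ i ∈ t, ∀ j ∈ t, i ≠ j → 6 ≤ nsq (a i - a j)) :
    ∑ i ∈ t, (1 - nsq (a i) / 3) ≤ 1 := by
  rcases t.eq_empty_or_nonempty with rfl | hne
  · simp
  have hm : (0:ℝ) < t.card := by exact_mod_cast hne.card_pos
  have h1 : ∑ i ∈ t, ∑ j ∈ t, nsq (a i - a j) ≤ 2 * t.card * ∑ i ∈ t, nsq (a i) := by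
    have e1 : ∀ k, ∑ i ∈ t, ∑ j ∈ t, (a i k - a j k)^2 ≤ 2 * t.card * ∑ i ∈ t, (a i k)^2 := by
      intro k
      have : ∑ i ∈ t, ∑ j ∈ t, (a i k - a j k)^2
        = 2 * t.card * ∑ i ∈ t, (a i k)^2 - 2 * (∑ i ∈ t, a i k)^2 := by
        have : ∀ i j, (a i k - a j k)^2 = (a i k)^2 - 2 * (a i k * a j k) + (a j k)^2 := by
          intros; ring
        simp only [this, Finset.sum_add_distrib, Finset.sum_sub_distrib, ← Finset.mul_sum,
          Finset.sum_const, nsmul_eq_mul, ← Finset.sum_mul]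
        ring
      rw [this]
      nlinarith [sq_nonneg (∑ i ∈ t, a i k)]
    have : ∑ i ∈ t, ∑ j ∈ t, nsq (a i - a j) = ∑ k, ∑ i ∈ t, ∑ j ∈ t, (a i k - a j k)^2 := by
      unfold nsq
      rw [Finset.sum_comm]
      rw [Finset.sum_congr rfl (fun i _ => Finset.sum_comm)]
      rw [Finset.sum_comm]
      refine Finset.sum_congr rfl fun k _ => ?_
      rw [Finset.sum_comm]
      simp
    rw [this]
    refine (Finset.sum_le_sum fun k _ => e1 k).trans_eq ?_
    rw [← Finset.mul_sum]
    unfold nsq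
    rw [Finset.sum_comm]
  have h2 : ∑ i ∈ t, ∑ j ∈ t, (6 - if i = j then (6:ℝ) else 0) ≤ ∑ i ∈ t, ∑ j ∈ t, nsq (a i - a j) := by
    refine Finset.sum_le_sum fun i hi => Finset.sum_le_sum fun j hj => ?_
    split_ifs with hij
    · subst hij; simp [nsq]
    · simpa using h i hi j hj hij
  have h3 : ∑ i ∈ t, ∑ j ∈ t, (6 - if i = j then (6:ℝ) else 0) = 6 * t.card * (t.card - 1) := by
    have : ∀ i ∈ t, ∑ j ∈ t, (6 - if i = j then (6:ℝ) else 0) = 6 * t.card - 6 := by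
      intro i hi
      rw [Finset.sum_sub_distrib]
      simp [hi, mul_comm]
    rw [Finset.sum_congr rfl this]
    simp; ring
  rw [h3] at h2
  have h4 := h2.trans h1
  have h5 : 3 * ((t.card : ℝ) - 1) ≤ ∑ i ∈ t, nsq (a i) := by
    nlinarith
  rw [Finset.sum_sub_distrib, ← Finset.sum_div]
  simp only [Finset.sum_const, nsmul_eq_mul, mul_one]
  linarith

lemma weights {n : ℕ} {ι : Type*} (t : Finset ι) (a : ι → Fin n → ℝ)
    (h : ∀ i ∈ t, ∀ j ∈ t, i ≠ j → 6 ≤ nsq (a i - a j)) :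
    ∑ i ∈ t, ENNReal.ofReal (1 - nsq (a i) / 3) ≤ 1 := by
  classical
  rw [← Finset.sum_filter_add_sum_filter_not t (fun i => 0 ≤ 1 - nsq (a i) / 3)]
  rw [Finset.sum_eq_zero (s := t.filter (fun i => ¬ 0 ≤ 1 - nsq (a i) / 3)), add_zero]
  · rw [← ENNReal.ofReal_sum_of_nonneg]
    · rw [← ENNReal.ofReal_one]
      apply ENNReal.ofReal_le_ofReal
      apply weights_aux
      intro i hi j hj
      exact h i (Finset.mem_filter.1 hi).1 j (Finset.mem_filter.1 hj).1
    · intro i hi; exact (Finset.mem_filter.1 hi).2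
  · intro i hi
    have := (Finset.mem_filter.1 hi).2
    exact ENNReal.ofReal_of_nonpos (by linarith)

lemma nsq_meas {n : ℕ} : Measurable (fun x : Fin n → ℝ => ENNReal.ofReal (1 - nsq x / 3)) := by
  unfold nsq
  fun_prop

open MeasureTheory in
lemma packing {n : ℕ} (b : Module.Basis (Fin n) ℝ (Fin n → ℝ))
    (h : ∀ z : Fin n → ℤ, z ≠ 0 → 6 ≤ nsq (∑ i, (z i : ℝ) • b i)) :
    ∫⁻ x : Fin n → ℝ, ENNReal.ofReal (1 - nsq x / 3) ≤ ENNReal.ofReal |(Matrix.of b).det| := by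
  rw [← ZSpan.volume_fundamentalDomain b]
  have hfd := ZSpan.isAddFundamentalDomain' b (volume : Measure (Fin n → ℝ))
  have : Countable (Submodule.span ℤ (Set.range b)).toAddSubgroup :=
    inferInstanceAs (Countable (Submodule.span ℤ (Set.range b)))
  rw [hfd.lintegral_eq_tsum'']
  rw [← lintegral_tsum]
  · refine (lintegral_mono (g := fun _ => 1) ?_).trans ?_
    · intro x
      dsimp only
      rw [ENNReal.tsum_eq_iSup_sum]
      refine iSup_le fun t => ?_
      refine weights t (fun i => i +ᵥ x) ?_
      intro i _ j _ hij
      have : ((i +ᵥ x) - (j +ᵥ x) : Fin n → ℝ) = (i : Fin n → ℝ) - j := by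
        simp [AddSubgroup.vadd_def]
      rw [this]
      have hmem : (i : Fin n → ℝ) - j ∈ Submodule.span ℤ (Set.range b) :=
        Submodule.sub_mem _ i.2 j.2
      rw [Submodule.mem_span_range_iff_exists_fun] at hmem
      obtain ⟨c, hc⟩ := hmem
      rw [← hc]
      have := h c ?_
      · simpa only [Int.cast_smul_eq_zsmul] using this
      · rintro rfl
        simp at hc
        exact hij (Subtype.ext (sub_eq_zero.1 hc.symm))
    · simp
  · intro i
    exact (nsq_meas.comp (measurable_const_vadd i)).aemeasurable

open MeasureTheory in
lemma integral_weight {n : ℕ} (hn : 0 < n) :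
    (∫⁻ x : Fin n → ℝ, ENNReal.ofReal (1 - nsq x / 3)).toReal =
      (√Real.pi ^ n / Real.Gamma (n / 2 + 1)) * (√3 ^ n * 2 / (n + 2)) := by
  have : Nonempty (Fin n) := ⟨⟨0, hn⟩⟩
  rw [← (PiLp.volume_preserving_ofLp (Fin n)).lintegral_comp nsq_meas]
  have e : ∀ x : EuclideanSpace ℝ (Fin n), nsq (WithLp.ofLp x) = ‖x‖^2 := by
    intro x
    rw [EuclideanSpace.norm_sq_eq]; simp [nsq]
  simp only [e]
  have e2 : ∀ x : EuclideanSpace ℝ (Fin n), ENNReal.ofReal (1 - ‖x‖^2/3)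
     = ENNReal.ofReal (max (1 - ‖x‖^2/3) 0) := by
    intro x; simp
  simp only [e2]
  rw [← integral_eq_lintegral_of_nonneg_ae (f := fun x : EuclideanSpace ℝ (Fin n) => max (1 - ‖x‖^2/3) 0)
    (Filter.Eventually.of_forall fun x => le_max_right _ _)
    (by fun_prop)]
  rw [integral_fun_norm_addHaar volume (fun y => max (1 - y^2/3) 0)]
  have hvol : (volume : Measure (EuclideanSpace ℝ (Fin n))).real (Metric.ball 0 1)
     = √Real.pi ^ n / Real.Gamma (n / 2 + 1) := by
    rw [Measure.real, EuclideanSpace.volume_ball]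
    simp
    have : 0 < Real.Gamma ((n:ℝ) / 2 + 1) := Real.Gamma_pos_of_pos (by positivity)
    positivity
  rw [hvol, finrank_euclideanSpace_fin]
  have h3 : √3 ^ 2 = (3:ℝ) := Real.sq_sqrt (by norm_num)
  have h3p : (0:ℝ) < √3 := by positivity
  have hIval : ∫ y in Set.Ioi (0:ℝ), y ^ (n-1) • max (1 - y^2/3) 0 = √3 ^ n * 2 / (n * (n + 2)) := by
    have : ∫ y in Set.Ioi (0:ℝ), y ^ (n-1) • max (1 - y^2/3) 0
      = ∫ y in Set.Ioc (0:ℝ) √3, y ^ (n-1) • max (1 - y^2/3) 0 := by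
      apply setIntegral_eq_of_subset_of_forall_sdiff_eq_zero measurableSet_Ioi
      · intro x hx; exact hx.1
      · intro x hx
        have h1 : 0 < x := hx.1
        have h2 : √3 < x := by
          by_contra hc
          exact hx.2 ⟨h1, not_lt.1 hc⟩
        rw [max_eq_right (by nlinarith)]
        simp
    rw [this]
    have : ∫ y in Set.Ioc (0:ℝ) √3, y ^ (n-1) • max (1 - y^2/3) 0
      = ∫ y in Set.Ioc (0:ℝ) √3, (y ^ (n-1) - y ^ (n+1) / 3) := by
      apply setIntegral_congr_fun measurableSet_Ioc
      intro x hx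
      have h1 : 0 < x := hx.1
      have h2 : x ≤ √3 := hx.2
      dsimp only
      rw [max_eq_left (by nlinarith), show n + 1 = (n - 1) + 2 by omega, pow_add]
      simp; ring
    rw [this, ← intervalIntegral.integral_of_le h3p.le, intervalIntegral.integral_sub,
      intervalIntegral.integral_div, integral_pow, integral_pow]
    · obtain ⟨m, rfl⟩ : ∃ m, n = m + 1 := ⟨n - 1, by omega⟩
      simp only [Nat.add_sub_cancel]
      rw [show m + 1 + 1 + 1 = (m + 1) + 2 by ring, pow_add _ (m+1) 2, h3]
      push_cast
      field_simp
      simp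
      ring
    · apply Continuous.intervalIntegrable; fun_prop
    · apply Continuous.intervalIntegrable; fun_prop
  rw [hIval]
  simp only [nsmul_eq_mul, smul_eq_mul]
  field_simp

lemma blichfeldt {n : ℕ} (hn : 0 < n) (b : Module.Basis (Fin n) ℝ (Fin n → ℝ))
    (h : ∀ z : Fin n → ℤ, z ≠ 0 → 6 ≤ nsq (∑ i, (z i : ℝ) • b i)) :
    (√Real.pi ^ n / Real.Gamma (n / 2 + 1)) * (√3 ^ n * 2 / (n + 2)) ≤ |(Matrix.of b).det| := by
  rw [← integral_weight hn]
  refine ENNReal.toReal_le_of_le_ofReal (abs_nonneg _) (packing b h)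

open scoped MatrixOrder in
lemma blichfeldt_gram {n : ℕ} (hn : 0 < n) (G : Matrix (Fin n) (Fin n) ℝ) (hG : G.PosDef)
    (h : ∀ z : Fin n → ℤ, z ≠ 0 → 6 ≤ (fun i => (z i : ℝ)) ⬝ᵥ (G *ᵥ (fun i => (z i : ℝ)))) :
    ((√Real.pi ^ n / Real.Gamma (n / 2 + 1)) * (√3 ^ n * 2 / (n + 2))) ^ 2 ≤ G.det := by
  obtain ⟨B, hB, hGB⟩ : ∃ B : Matrix (Fin n) (Fin n) ℝ, IsUnit B ∧ G = Bᵀ * B := by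
    obtain ⟨B, hB⟩ := CStarAlgebra.nonneg_iff_eq_star_mul_self.mp hG.posSemidef.nonneg
    have hu := hG.isUnit
    refine ⟨B, ?_, hB⟩
    rw [Matrix.isUnit_iff_isUnit_det] at hu ⊢
    rw [hB, det_mul] at hu
    exact (IsUnit.mul_iff.1 hu).2
  have hdet : IsUnit B.det := (Matrix.isUnit_iff_isUnit_det _).1 hB
  let b : Module.Basis (Fin n) ℝ (Fin n → ℝ) := (Pi.basisFun ℝ (Fin n)).map
    (LinearEquiv.ofIsUnitDet (f := Matrix.toLin' B) (v := Pi.basisFun ℝ (Fin n)) (v' := Pi.basisFun ℝ (Fin n)) (by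
      rw [← Matrix.toLin_eq_toLin', LinearMap.toMatrix_toLin]; exact hdet))
  have hb : ∀ i, b i = B.col i := by
    intro i; ext j
    simp [b]
  have hbm : Matrix.of b = Bᵀ := by
    ext i j; simp [hb]
  have := blichfeldt hn b ?_
  · rw [hbm] at this
    have h0 : 0 ≤ (√Real.pi ^ n / Real.Gamma (n / 2 + 1)) * (√3 ^ n * 2 / (n + 2)) := by
      have : 0 < Real.Gamma ((n:ℝ) / 2 + 1) := Real.Gamma_pos_of_pos (by positivity)
      positivity
    refine (pow_le_pow_left₀ h0 this 2).trans_eq ?_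
    rw [hGB, sq_abs, det_mul, sq]
    simp
  · intro z hz
    refine (h z hz).trans_eq ?_
    have e : ∑ i, (z i : ℝ) • b i = B *ᵥ (fun i => (z i : ℝ)) := by
      ext j
      simp [hb, Matrix.mulVec, dotProduct, mul_comm]
    rw [e, hGB, ← Matrix.mulVec_mulVec, Matrix.dotProduct_mulVec, Matrix.vecMul_transpose]
    simp [nsq, dotProduct, sq]

lemma posDef_of_int {n : ℕ} (G : Matrix (Fin n) (Fin n) ℤ) (hs : Gᵀ = G)
    (h : ∀ z : Fin n → ℤ, z ≠ 0 → 0 < z ⬝ᵥ (G *ᵥ z)) :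
    (G.map (Int.cast : ℤ → ℝ)).PosDef := by
  have hpsd : (G.map (Int.cast : ℤ → ℝ)).PosSemidef := by
    refine .of_dotProduct_mulVec_nonneg ?_ ?_
    · ext i j
      have := congr_fun (congr_fun hs i) j
      simpa using this
    · intro x
      have hd : DenseRange (fun q : Fin n → ℚ => fun i => (q i : ℝ)) :=
        DenseRange.piMap (fun _ => Rat.denseRange_cast)
      have hc : IsClosed {x : Fin n → ℝ | 0 ≤ star x ⬝ᵥ ((G.map (Int.cast : ℤ → ℝ)) *ᵥ x)} := by
        apply isClosed_le
        · fun_prop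
        · simp only [dotProduct, mulVec, star_trivial]
          fun_prop
      refine hd.induction_on (p := fun x => 0 ≤ star x ⬝ᵥ ((G.map (Int.cast : ℤ → ℝ)) *ᵥ x)) x hc ?_
      intro q
      obtain ⟨d, hd⟩ := IsLocalization.exist_integer_multiples_of_finite (nonZeroDivisors ℤ) q
      choose z hz using hd
      have hd0 : ((d : ℤ) : ℝ) ≠ 0 := by
        exact_mod_cast nonZeroDivisors.ne_zero d.2
      have hz' : ∀ i, (z i : ℝ) = (d : ℤ) * (q i : ℝ) := by
        intro i
        have := hz i
        simp [Algebra.smul_def] at this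
        exact_mod_cast this
      have h0 : 0 ≤ z ⬝ᵥ (G *ᵥ z) := by
        by_cases hz0 : z = 0
        · simp [hz0]
        · exact (h z hz0).le
      have h1 : ((z ⬝ᵥ (G *ᵥ z) : ℤ) : ℝ) = ((d : ℤ) : ℝ)^2 *
          ((fun i => (q i : ℝ)) ⬝ᵥ ((G.map (Int.cast : ℤ → ℝ)) *ᵥ (fun i => (q i : ℝ)))) := by
        simp only [dotProduct, mulVec, Int.cast_sum, Int.cast_mul, hz', Finset.mul_sum, Matrix.map_apply]
        refine Finset.sum_congr rfl fun i _ => Finset.sum_congr rfl fun j _ => ?_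
        ring
      have h2 : (0:ℝ) ≤ ((z ⬝ᵥ (G *ᵥ z) : ℤ) : ℝ) := by exact_mod_cast h0
      rw [h1] at h2
      have h3 : 0 < ((d : ℤ) : ℝ)^2 := by positivity
      simp only [star_trivial]
      exact nonneg_of_mul_nonneg_right h2 h3
  rw [hpsd.posDef_iff_det_ne_zero]
  have : (G.map (Int.cast : ℤ → ℝ)).det = (G.det : ℝ) := by
    have := RingHom.map_det (Int.castRingHom ℝ) G
    simpa using this.symm
  rw [this]
  intro h0
  have h0' : G.det = 0 := by exact_mod_cast h0
  obtain ⟨v, hv, hv2⟩ := Matrix.exists_mulVec_eq_zero_iff.2 h0'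
  have := h v hv
  rw [hv2] at this
  simp at this

lemma blichfeldt_int {n : ℕ} (hn : 0 < n) (G : Matrix (Fin n) (Fin n) ℤ) (hs : Gᵀ = G)
    (h : ∀ z : Fin n → ℤ, z ≠ 0 → 6 ≤ z ⬝ᵥ (G *ᵥ z)) :
    0 < G.det ∧
    ((√Real.pi ^ n / Real.Gamma (n / 2 + 1)) * (√3 ^ n * 2 / (n + 2))) ^ 2 ≤ (G.det : ℝ) := by
  have hp := posDef_of_int G hs (fun z hz => lt_of_lt_of_le (by norm_num) (h z hz))
  have hdet : (G.map (Int.cast : ℤ → ℝ)).det = (G.det : ℝ) := by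
    have := RingHom.map_det (Int.castRingHom ℝ) G
    simpa using this.symm
  constructor
  · have := hp.det_pos
    rw [hdet] at this
    exact_mod_cast this
  · rw [← hdet]
    apply blichfeldt_gram hn _ hp
    intro z hz
    have := h z hz
    have h2 : (6:ℝ) ≤ ((z ⬝ᵥ (G *ᵥ z) : ℤ) : ℝ) := by exact_mod_cast this
    refine h2.trans_eq ?_
    simp [dotProduct, mulVec]
noncomputable def Wb (n : ℕ) : ℝ :=
  ((√Real.pi ^ n / Real.Gamma (n / 2 + 1)) * (√3 ^ n * 2 / (n + 2))) ^ 2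

lemma Wb_one : Wb 1 = 16 / 3 := by
  unfold Wb
  have : Real.Gamma (((1:ℕ):ℝ) / 2 + 1) = 1 / 2 * √Real.pi := by
    rw [Real.Gamma_add_one (by norm_num)]
    rw [← Real.Gamma_one_half_eq]; simp
  rw [this]
  have h1 : √Real.pi ≠ 0 := by positivity
  have h3 : √3 ^ 2 = (3:ℝ) := Real.sq_sqrt (by norm_num)
  field_simp
  rw [h3]; norm_num

lemma Wb_step (n : ℕ) (q : ℝ) (h : q ≤ Wb n) : q * 355 / (n + 4)^2 ≤ Wb (n+2) := by
  have hg : 0 < Real.Gamma ((n:ℝ) / 2 + 1) := Real.Gamma_pos_of_pos (by positivity)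
  have h3 : √3 ^ 2 = (3:ℝ) := Real.sq_sqrt (by norm_num)
  have hpi : √Real.pi ^ 2 = Real.pi := Real.sq_sqrt Real.pi_pos.le
  have e : Wb (n+2) = Wb n * (36 * Real.pi ^ 2) / (n+4)^2 := by
    unfold Wb
    have : Real.Gamma (((n+2:ℕ):ℝ) / 2 + 1) = ((n:ℝ)/2+1) * Real.Gamma ((n:ℝ) / 2 + 1) := by
      rw [← Real.Gamma_add_one (by positivity)]
      congr 1; push_cast; ring
    rw [this, pow_add, pow_add, h3, hpi]
    push_cast
    field_simp
    ring
  rw [e]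
  have hw : 0 ≤ Wb n := by unfold Wb; positivity
  have h36 : (355:ℝ) ≤ 36 * Real.pi ^ 2 := by nlinarith [Real.pi_gt_d6]
  gcongr
  
lemma Wb_zero : Wb 0 = 1 := by simp [Wb]

lemma Wb_even (k : ℕ) : ∏ i ∈ Finset.range k, (355 / (2 * i + 4)^2 : ℝ) ≤ Wb (2 * k) := by
  induction k with
  | zero => simp [Wb_zero]
  | succ k ih =>
    rw [Finset.prod_range_succ]
    have := Wb_step _ _ ih
    push_cast at this
    rw [mul_add, mul_one]
    refine le_trans (le_of_eq ?_) this
    ring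

lemma Wb_odd (k : ℕ) : 16 / 3 * ∏ i ∈ Finset.range k, (355 / (2 * i + 5)^2 : ℝ) ≤ Wb (2 * k + 1) := by
  induction k with
  | zero => simp [Wb_one]
  | succ k ih =>
    rw [Finset.prod_range_succ]
    have := Wb_step _ _ ih
    push_cast at this
    rw [show 2 * (k+1) + 1 = 2 * k + 1 + 2 by ring]
    refine le_trans (le_of_eq ?_) this
    ring

lemma num2a (n : ℕ) (h0 : 0 < n) (h : n ≤ 14) : (2:ℝ)^n < Wb n := by
  rcases Nat.even_or_odd' n with ⟨k, rfl | rfl⟩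
  · have hk : k ≤ 7 := by omega
    refine lt_of_lt_of_le ?_ (Wb_even k)
    interval_cases k <;> norm_num [Finset.prod_range_succ] at *
  · have hk : k ≤ 6 := by omega
    refine lt_of_lt_of_le ?_ (Wb_odd k)
    interval_cases k <;> norm_num [Finset.prod_range_succ]

lemma num2b (n : ℕ) (h0 : 15 ≤ n) (h : n ≤ 21) : 3 * (2:ℝ)^(24-n) < Wb n := by
  rcases Nat.even_or_odd' n with ⟨k, rfl | rfl⟩
  · have hk : k ≤ 10 := by omega
    have hk : 8 ≤ k := by omega
    refine lt_of_lt_of_le ?_ (Wb_even k)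
    interval_cases k <;> norm_num [Finset.prod_range_succ] at *
  · have hk : k ≤ 10 := by omega
    have hk : 7 ≤ k := by omega
    refine lt_of_lt_of_le ?_ (Wb_odd k)
    interval_cases k <;> norm_num [Finset.prod_range_succ]

lemma num3a (n : ℕ) (h0 : 0 < n) (h : n ≤ 18) : (3:ℝ)^n < (Wb n)^2 := by
  rcases Nat.even_or_odd' n with ⟨k, rfl | rfl⟩
  · have hk : k ≤ 9 := by omega
    refine lt_of_lt_of_le ?_ (pow_le_pow_left₀ (by positivity) (Wb_even k) 2)
    interval_cases k <;> norm_num [Finset.prod_range_succ] at *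
  · have hk : k ≤ 8 := by omega
    refine lt_of_lt_of_le ?_ (pow_le_pow_left₀ (by positivity) (Wb_odd k) 2)
    interval_cases k <;> norm_num [Finset.prod_range_succ]

lemma num3b (n : ℕ) (h0 : 19 ≤ n) (h : n ≤ 21) : 3 * (3:ℝ)^(24-n) < Wb n := by
  rcases Nat.even_or_odd' n with ⟨k, rfl | rfl⟩
  · obtain rfl : k = 10 := by omega
    refine lt_of_lt_of_le ?_ (Wb_even _)
    norm_num [Finset.prod_range_succ] at *
  · have hk : k ≤ 10 := by omega
    have hk : 9 ≤ k := by omega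
    refine lt_of_lt_of_le ?_ (Wb_odd k)
    interval_cases k <;> norm_num [Finset.prod_range_succ]

lemma num5 (n : ℕ) (h0 : 0 < n) (h : n ≤ 21) : (5:ℝ)^n < (Wb n)^4 := by
  rcases Nat.even_or_odd' n with ⟨k, rfl | rfl⟩
  · have hk : k ≤ 10 := by omega
    refine lt_of_lt_of_le ?_ (pow_le_pow_left₀ (by positivity) (Wb_even k) 4)
    interval_cases k <;> norm_num [Finset.prod_range_succ] at *
  · have hk : k ≤ 10 := by omega
    refine lt_of_lt_of_le ?_ (pow_le_pow_left₀ (by positivity) (Wb_odd k) 4)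
    interval_cases k <;> norm_num [Finset.prod_range_succ]

lemma pow_five (p : ℕ) (hp : 5 ≤ p) : p ^ 4 ≤ 5 ^ (p - 1) := by
  induction p, hp using Nat.le_induction with
  | base => norm_num
  | succ k hk ih =>
    obtain ⟨m, rfl⟩ : ∃ m, k = m + 5 := ⟨k - 5, by omega⟩
    simp only [show m + 5 + 1 - 1 = (m + 5 - 1) + 1 by omega, pow_succ 5 (m + 5 - 1)]
    refine le_trans ?_ (Nat.mul_le_mul_right 5 ih)
    ring_nf
    have : m^2 ≤ m^3 + m := by nlinarith [sq_nonneg ((m:ℤ)-1), Nat.zero_le m, pow_nonneg (Nat.zero_le m) 3, (by zify; nlinarith [sq_nonneg ((m:ℤ)-1)] : 2*m ≤ m^2 + 1)]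
    nlinarith

lemma numeric (n p : ℕ) (hp : p.Prime) (D : ℤ) (hD : 0 < D) (h0 : 0 < n) (h : n ≤ 21)
    (h1 : D ^ (p-1) ≤ (p:ℤ) ^ n) (h2 : D ≤ 3 * (p:ℤ)^(24 - n)) (h3 : Wb n ≤ (D:ℝ)) : False := by
  have hW : 0 ≤ Wb n := by unfold Wb; positivity
  have hp2 := hp.two_le
  rcases (show p = 2 ∨ p = 3 ∨ p = 4 ∨ 5 ≤ p by omega) with rfl | rfl | rfl | hp5
  · rcases le_or_gt n 14 with hn | hn
    · have := num2a n h0 hn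
      have h1' : (D:ℝ) ≤ 2 ^ n := by exact_mod_cast (by simpa using h1)
      linarith
    · have := num2b n hn h
      have h1' : (D:ℝ) ≤ 3 * 2 ^ (24 - n) := by exact_mod_cast h2
      linarith
  · rcases le_or_gt n 18 with hn | hn
    · have := num3a n h0 hn
      have h1' : (D:ℝ)^2 ≤ 3 ^ n := by exact_mod_cast h1
      have := pow_le_pow_left₀ hW h3 2
      linarith
    · have := num3b n hn h
      have h1' : (D:ℝ) ≤ 3 * 3 ^ (24 - n) := by exact_mod_cast h2
      linarith
  · exact absurd hp (by norm_num)
  · have := num5 n h0 h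
    have h4 : D ^ 4 ≤ 5 ^ n := by
      have h6 : (D^4)^(p-1) ≤ (5^n)^(p-1) := by
        calc (D^4)^(p-1) = (D^(p-1))^4 := by ring
          _ ≤ ((p:ℤ)^n)^4 := by gcongr
          _ = ((p:ℤ)^4)^n := by ring
          _ ≤ (5^(p-1))^n := by
            gcongr
            exact_mod_cast pow_five p hp5
          _ = _ := by ring
      exact le_of_pow_le_pow_left₀ (by omega) (by positivity) h6
    have h1' : (D:ℝ)^4 ≤ 5 ^ n := by exact_mod_cast h4
    have := pow_le_pow_left₀ hW h3 4
    linarith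
open Polynomial in
lemma prod_zero_of_geom {R : Type*} [Ring R] (p : ℕ) (hp : p.Prime) (f : R)
    (hf : ∑ i ∈ Finset.range p, f ^ i = 0) :
    aeval f (∏ k ∈ Finset.range (p-1), (1 - X ^ (k+1)) : ℤ[X]) = (p : R) := by
  obtain ⟨m, rfl⟩ : ∃ m, p = m + 1 := ⟨p - 1, by have := hp.pos; omega⟩
  have : Fact (m+1).Prime := ⟨hp⟩
  have hz := Complex.isPrimitiveRoot_exp (m+1) (by omega)
  set ζ := Complex.exp (2 * Real.pi * Complex.I / ((m+1 : ℕ):ℂ))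
  have h1 := hz.prod_one_sub_pow_eq_order
  have hd : cyclotomic (m+1) ℤ ∣ (∏ k ∈ Finset.range m, (1 - X ^ (k+1)) : ℤ[X]) - ((m+1 : ℕ) : ℤ[X]) := by
    rw [cyclotomic_eq_minpoly hz (by omega)]
    apply minpoly.isIntegrallyClosed_dvd (hz.isIntegral (by omega))
    simp only [map_sub, map_prod, map_one, map_pow, aeval_X, map_natCast]
    rw [h1]; push_cast; ring
  have h0 : aeval f (cyclotomic (m+1) ℤ) = 0 := by
    rw [cyclotomic_prime]
    simpa using hf
  obtain ⟨q, hq⟩ := hd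
  have := congrArg (aeval f) hq
  rw [map_mul, h0, zero_mul, map_sub, sub_eq_zero] at this
  simpa using this

open Polynomial in
lemma det_one_sub {M : Type*} [AddCommGroup M] [Module.Free ℤ M] [Module.Finite ℤ M]
    (p : ℕ) (hp : p.Prime) (f : Module.End ℤ M) (hf : ∑ i ∈ Finset.range p, f ^ i = 0) :
    |LinearMap.det (1 - f)| ^ (p-1) = (p:ℤ) ^ Module.finrank ℤ M := by
  have hfp : f ^ p = 1 := by
    have := geom_sum_mul f p
    rw [hf, zero_mul] at this
    exact (sub_eq_zero.1 this.symm)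
  have h1 := prod_zero_of_geom p hp f hf
  have h2 : ∀ k ∈ Finset.range (p-1), |LinearMap.det (aeval f (1 - X ^ (k+1) : ℤ[X]))| = |LinearMap.det (1 - f)| := by
    intro k hk
    have hk' : k + 1 < p := by have := Finset.mem_range.1 hk; omega
    have dvd : ∀ (a : Module.End ℤ M) (j : ℕ), LinearMap.det (1 - a) ∣ LinearMap.det (1 - a ^ j) := by
      intro a j
      rw [← mul_neg_geom_sum, map_mul]
      exact dvd_mul_right _ _
    rw [abs_eq_abs]
    simp only [map_sub, map_one, map_pow, aeval_X]
    apply Int.associated_iff.1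
    apply associated_of_dvd_dvd
    · have hc : Nat.Coprime (k+1) p := by
        exact ((Nat.Prime.coprime_iff_not_dvd hp).2 (fun hd => by have := Nat.le_of_dvd (by omega) hd; omega)).symm
      obtain ⟨j, -, hj⟩ := Nat.exists_mul_mod_eq_one_of_coprime hc hp.one_lt
      have : f = (f ^ (k+1)) ^ j := by
        rw [← pow_mul, ← Nat.mod_add_div ((k+1)*j) p, pow_add, pow_mul, hfp, hj]; simp
      conv_rhs => rw [this]
      exact dvd _ _
    · exact dvd _ _
  have h3 : LinearMap.det (aeval f (∏ k ∈ Finset.range (p-1), (1 - X ^ (k+1)) : ℤ[X]))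
     = ∏ k ∈ Finset.range (p-1), LinearMap.det (aeval f (1 - X ^ (k+1) : ℤ[X])) := by
    generalize p - 1 = q
    induction q with
    | zero => simp
    | succ q ih => rw [Finset.prod_range_succ, Finset.prod_range_succ, map_mul, map_mul, ih]
  have h4 : |LinearMap.det ((p : Module.End ℤ M))| = (p:ℤ)^Module.finrank ℤ M := by
    have : (p : Module.End ℤ M) = (p : ℤ) • (LinearMap.id) := by
      ext x; simp
    rw [this, LinearMap.det_smul]; simp
  rw [← h4, ← h1, h3, Finset.abs_prod, Finset.prod_congr rfl h2]
  simp
def luP : Matrix (Fin 24) (Fin 24) ℤ :=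
  !![1, 0, 0, 0, 0, 0, 0, 0, 0, 0, 0, 0, 0, 0, 0, 0, 0, 0, 0, 0, 0, 0, 0, 0;
    -1, 1, 0, 0, 0, 0, 0, 0, 0, 0, 0, 0, 0, 0, 0, 0, 0, 0, 0, 0, 0, 0, 0, 0;
    0, 0, 1, 0, 0, 0, 0, 0, 0, 0, 0, 0, 0, 0, 0, 0, 0, 0, 0, 0, 0, 0, 0, 0;
    0, 0, -1, 1, 0, 0, 0, 0, 0, 0, 0, 0, 0, 0, 0, 0, 0, 0, 0, 0, 0, 0, 0, 0;
    0, 0, 0, 0, 1, 0, 0, 0, 0, 0, 0, 0, 0, 0, 0, 0, 0, 0, 0, 0, 0, 0, 0, 0;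
    0, 0, 0, 0, -1, 1, 0, 0, 0, 0, 0, 0, 0, 0, 0, 0, 0, 0, 0, 0, 0, 0, 0, 0;
    0, 0, 0, 0, 0, 0, 1, 0, 0, 0, 0, 0, 0, 0, 0, 0, 0, 0, 0, 0, 0, 0, 0, 0;
    0, 0, 0, 0, 0, 0, 0, 1, 0, 0, 0, 0, 0, 0, 0, 0, 0, 0, 0, 0, 0, 0, 0, 0;
    0, 0, 0, 0, 0, 0, 1, 0, 2, 0, 0, 0, 0, 0, 0, 0, 0, 0, 0, 0, 0, 0, 0, 0;
    0, 0, 0, 0, 0, 0, 2, 3, 4, 6, 0, 0, 0, 0, 0, 0, 0, 0, 0, 0, 0, 0, 0, 0;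
    0, 0, 0, 0, 0, 0, 2, 3, 4, 6, 5, 0, 0, 0, 0, 0, 0, 0, 0, 0, 0, 0, 0, 0;
    0, 0, 0, 0, 0, 0, 2, 3, 4, 6, 5, 4, 0, 0, 0, 0, 0, 0, 0, 0, 0, 0, 0, 0;
    0, 0, 0, 0, 0, 0, 2, 3, 4, 6, 5, 4, 3, 0, 0, 0, 0, 0, 0, 0, 0, 0, 0, 0;
    0, 0, 0, 0, 0, 0, 2, 3, 4, 6, 5, 4, 3, 2, 0, 0, 0, 0, 0, 0, 0, 0, 0, 0;
    0, 0, 0, 0, 0, 0, 0, 0, 0, 0, 0, 0, 0, 0, 1, 0, 0, 0, 0, 0, 0, 0, 0, 0;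
    0, 0, 0, 0, 0, 0, 0, 0, 0, 0, 0, 0, 0, 0, 0, 1, 0, 0, 0, 0, 0, 0, 0, 0;
    0, 0, 0, 0, 0, 0, 0, 0, 0, 0, 0, 0, 0, 0, 1, 0, 2, 0, 0, 0, 0, 0, 0, 0;
    0, 0, 0, 0, 0, 0, 0, 0, 0, 0, 0, 0, 0, 0, 2, 3, 4, 6, 0, 0, 0, 0, 0, 0;
    0, 0, 0, 0, 0, 0, 0, 0, 0, 0, 0, 0, 0, 0, 2, 3, 4, 6, 5, 0, 0, 0, 0, 0;
    0, 0, 0, 0, 0, 0, 0, 0, 0, 0, 0, 0, 0, 0, 2, 3, 4, 6, 5, 4, 0, 0, 0, 0;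
    0, 0, 0, 0, 0, 0, 0, 0, 0, 0, 0, 0, 0, 0, 2, 3, 4, 6, 5, 4, 3, 0, 0, 0;
    0, 0, 0, 0, 0, 0, 0, 0, 0, 0, 0, 0, 0, 0, 2, 3, 4, 6, 5, 4, 3, 2, 0, 0;
    0, 0, 0, 0, 0, 0, 0, 0, 0, 0, 0, 0, 0, 0, 0, 0, 0, 0, 0, 0, 0, 0, 1, 0;
    0, 0, 0, 0, 0, 0, 0, 0, 0, 0, 0, 0, 0, 0, 0, 0, 0, 0, 0, 0, 0, 0, 1, 2]

def luY : Matrix (Fin 24) (Fin 24) ℤ :=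
  !![1, 1, 0, 0, 0, 0, 0, 0, 0, 0, 0, 0, 0, 0, 0, 0, 0, 0, 0, 0, 0, 0, 0, 0;
    0, 1, 0, 0, 0, 0, 0, 0, 0, 0, 0, 0, 0, 0, 0, 0, 0, 0, 0, 0, 0, 0, 0, 0;
    0, 0, 1, 1, 0, 0, 0, 0, 0, 0, 0, 0, 0, 0, 0, 0, 0, 0, 0, 0, 0, 0, 0, 0;
    0, 0, 0, 1, 0, 0, 0, 0, 0, 0, 0, 0, 0, 0, 0, 0, 0, 0, 0, 0, 0, 0, 0, 0;
    0, 0, 0, 0, 1, 1, 0, 0, 0, 0, 0, 0, 0, 0, 0, 0, 0, 0, 0, 0, 0, 0, 0, 0;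
    0, 0, 0, 0, 0, 1, 0, 0, 0, 0, 0, 0, 0, 0, 0, 0, 0, 0, 0, 0, 0, 0, 0, 0;
    0, 0, 0, 0, 0, 0, 1, 0, 0, 0, 0, 0, 0, 0, 0, 0, 0, 0, 0, 0, 0, 0, 0, 0;
    0, 0, 0, 0, 0, 0, 0, 1, 0, 0, 0, 0, 0, 0, 0, 0, 0, 0, 0, 0, 0, 0, 0, 0;
    0, 0, 0, 0, 0, 0, 0, 0, 1, 0, 0, 0, 0, 0, 0, 0, 0, 0, 0, 0, 0, 0, 0, 0;
    0, 0, 0, 0, 0, 0, 0, 0, 0, 1, 0, 0, 0, 0, 0, 0, 0, 0, 0, 0, 0, 0, 0, 0;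
    0, 0, 0, 0, 0, 0, 0, 0, 0, 0, 1, 0, 0, 0, 0, 0, 0, 0, 0, 0, 0, 0, 0, 0;
    0, 0, 0, 0, 0, 0, 0, 0, 0, 0, 0, 1, 0, 0, 0, 0, 0, 0, 0, 0, 0, 0, 0, 0;
    0, 0, 0, 0, 0, 0, 0, 0, 0, 0, 0, 0, 1, 0, 0, 0, 0, 0, 0, 0, 0, 0, 0, 0;
    0, 0, 0, 0, 0, 0, 0, 0, 0, 0, 0, 0, 0, 1, 0, 0, 0, 0, 0, 0, 0, 0, 0, 0;
    0, 0, 0, 0, 0, 0, 0, 0, 0, 0, 0, 0, 0, 0, 1, 0, 0, 0, 0, 0, 0, 0, 0, 0;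
    0, 0, 0, 0, 0, 0, 0, 0, 0, 0, 0, 0, 0, 0, 0, 1, 0, 0, 0, 0, 0, 0, 0, 0;
    0, 0, 0, 0, 0, 0, 0, 0, 0, 0, 0, 0, 0, 0, 0, 0, 1, 0, 0, 0, 0, 0, 0, 0;
    0, 0, 0, 0, 0, 0, 0, 0, 0, 0, 0, 0, 0, 0, 0, 0, 0, 1, 0, 0, 0, 0, 0, 0;
    0, 0, 0, 0, 0, 0, 0, 0, 0, 0, 0, 0, 0, 0, 0, 0, 0, 0, 1, 0, 0, 0, 0, 0;
    0, 0, 0, 0, 0, 0, 0, 0, 0, 0, 0, 0, 0, 0, 0, 0, 0, 0, 0, 1, 0, 0, 0, 0;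
    0, 0, 0, 0, 0, 0, 0, 0, 0, 0, 0, 0, 0, 0, 0, 0, 0, 0, 0, 0, 1, 0, 0, 0;
    0, 0, 0, 0, 0, 0, 0, 0, 0, 0, 0, 0, 0, 0, 0, 0, 0, 0, 0, 0, 0, 1, 0, 0;
    0, 0, 0, 0, 0, 0, 0, 0, 0, 0, 0, 0, 0, 0, 0, 0, 0, 0, 0, 0, 0, 0, 1, 0;
    0, 0, 0, 0, 0, 0, 0, 0, 0, 0, 0, 0, 0, 0, 0, 0, 0, 0, 0, 0, 0, 0, 0, 1]

def luR : Matrix (Fin 24) (Fin 24) ℤ :=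
  !![1, 1, 0, 0, 0, 0, 0, 0, 0, 0, 0, 0, 0, 0, 0, 0, 0, 0, 0, 0, 0, 0, 0, 0;
    0, -1, 0, 0, 0, 0, 0, 0, 0, 0, 0, 0, 0, 0, 0, 0, 0, 0, 0, 0, 0, 0, 0, 0;
    0, 0, 1, 1, 0, 0, 0, 0, 0, 0, 0, 0, 0, 0, 0, 0, 0, 0, 0, 0, 0, 0, 0, 0;
    0, 0, 0, -1, 0, 0, 0, 0, 0, 0, 0, 0, 0, 0, 0, 0, 0, 0, 0, 0, 0, 0, 0, 0;
    0, 0, 0, 0, 1, 1, 0, 0, 0, 0, 0, 0, 0, 0, 0, 0, 0, 0, 0, 0, 0, 0, 0, 0;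
    0, 0, 0, 0, 0, -1, 0, 0, 0, 0, 0, 0, 0, 0, 0, 0, 0, 0, 0, 0, 0, 0, 0, 0;
    0, 0, 0, 0, 0, 0, -2, 0, 1, 0, 0, 0, 0, 0, 0, 0, 0, 0, 0, 0, 0, 0, 0, 0;
    0, 0, 0, 0, 0, 0, 0, -2, 0, 1, 0, 0, 0, 0, 0, 0, 0, 0, 0, 0, 0, 0, 0, 0;
    0, 0, 0, 0, 0, 0, 0, 0, -3, 2, 0, 0, 0, 0, 0, 0, 0, 0, 0, 0, 0, 0, 0, 0;
    0, 0, 0, 0, 0, 0, 0, 0, 0, -5, 6, 0, 0, 0, 0, 0, 0, 0, 0, 0, 0, 0, 0, 0;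
    0, 0, 0, 0, 0, 0, 0, 0, 0, 0, -4, 5, 0, 0, 0, 0, 0, 0, 0, 0, 0, 0, 0, 0;
    0, 0, 0, 0, 0, 0, 0, 0, 0, 0, 0, -3, 4, 0, 0, 0, 0, 0, 0, 0, 0, 0, 0, 0;
    0, 0, 0, 0, 0, 0, 0, 0, 0, 0, 0, 0, -2, 3, 0, 0, 0, 0, 0, 0, 0, 0, 0, 0;
    0, 0, 0, 0, 0, 0, 0, 0, 0, 0, 0, 0, 0, -1, 0, 0, 0, 0, 0, 0, 0, 0, 0, 0;
    0, 0, 0, 0, 0, 0, 0, 0, 0, 0, 0, 0, 0, 0, -2, 0, 1, 0, 0, 0, 0, 0, 0, 0;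
    0, 0, 0, 0, 0, 0, 0, 0, 0, 0, 0, 0, 0, 0, 0, -2, 0, 1, 0, 0, 0, 0, 0, 0;
    0, 0, 0, 0, 0, 0, 0, 0, 0, 0, 0, 0, 0, 0, 0, 0, -3, 2, 0, 0, 0, 0, 0, 0;
    0, 0, 0, 0, 0, 0, 0, 0, 0, 0, 0, 0, 0, 0, 0, 0, 0, -5, 6, 0, 0, 0, 0, 0;
    0, 0, 0, 0, 0, 0, 0, 0, 0, 0, 0, 0, 0, 0, 0, 0, 0, 0, -4, 5, 0, 0, 0, 0;
    0, 0, 0, 0, 0, 0, 0, 0, 0, 0, 0, 0, 0, 0, 0, 0, 0, 0, 0, -3, 4, 0, 0, 0;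
    0, 0, 0, 0, 0, 0, 0, 0, 0, 0, 0, 0, 0, 0, 0, 0, 0, 0, 0, 0, -2, 3, 0, 0;
    0, 0, 0, 0, 0, 0, 0, 0, 0, 0, 0, 0, 0, 0, 0, 0, 0, 0, 0, 0, 0, -1, 0, 0;
    0, 0, 0, 0, 0, 0, 0, 0, 0, 0, 0, 0, 0, 0, 0, 0, 0, 0, 0, 0, 0, 0, -2, 1;
    0, 0, 0, 0, 0, 0, 0, 0, 0, 0, 0, 0, 0, 0, 0, 0, 0, 0, 0, 0, 0, 0, 0, -3]

lemma luP_det : luP.det = 4147200 := by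
  rw [Matrix.det_of_lowerTriangular luP (by decide +kernel)]
  decide +kernel

lemma luY_det : luY.det = 1 := by
  rw [Matrix.det_of_upperTriangular (M := luY) (by decide +kernel)]
  decide +kernel

lemma luR_det : luR.det = -12441600 := by
  rw [Matrix.det_of_upperTriangular (M := luR) (by decide +kernel)]
  decide +kernel

lemma LGram_det : LGram.det = -3 := by
  have h : luP * (luY * LGram) = luR := by decide +kernel
  have := congrArg Matrix.det h
  rw [Matrix.det_mul, Matrix.det_mul, luP_det, luY_det, luR_det] at this
  omega

lemma LGram_symm : LGramᵀ = LGram := by decide +kernel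

def LHalf : Matrix (Fin 24) (Fin 24) ℤ :=
  Matrix.of fun i j => if i < j then LGram i j else if i = j then LGram i j / 2 else 0

lemma LHalf_add : LHalf + LHalfᵀ = LGram := by decide +kernel

/-- The bilinear form as a bundled bilinear map. -/
noncomputable def BL : LinearMap.BilinForm ℤ (Fin 24 → ℤ) := Matrix.toBilin' LGram

lemma Bf_eq (v w : Fin 24 → ℤ) : Bf v w = BL v w := by
  rw [BL, Matrix.toBilin'_apply', Bf]

lemma BL_symm (v w : Fin 24 → ℤ) : BL v w = BL w v := by
  rw [← Bf_eq, ← Bf_eq, Bf, Bf, dotProduct_comm, ← Matrix.vecMul_transpose, LGram_symm,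
    ← Matrix.dotProduct_mulVec]

lemma BL_even (v : Fin 24 → ℤ) : ∃ m, BL v v = 2 * m := by
  refine ⟨v ⬝ᵥ (LHalf *ᵥ v), ?_⟩
  rw [← Bf_eq, Bf, ← LHalf_add, Matrix.add_mulVec, dotProduct_add, Matrix.mulVec_transpose,
    dotProduct_comm v (v ᵥ* LHalf), ← Matrix.dotProduct_mulVec]
  ring

lemma BL_pos (v : Fin 24 → ℤ) (h0 : v 0 = v 1) (h2 : v 2 = v 3) (h4 : v 4 = v 5)
    (h : ∀ i, 6 ≤ i → v i = 0) : 0 ≤ BL v v := by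
  have : BL v v = 2 * v 1 ^ 2 + 2 * v 3 ^ 2 + 2 * v 5 ^ 2 := by
    have hv : v = v 1 • (Pi.single 0 1 + Pi.single 1 1) + v 3 • (Pi.single 2 1 + Pi.single 3 1)
      + v 5 • (Pi.single 4 1 + Pi.single 5 1) := by
      ext i
      fin_cases i <;> simp [h0, h2, h4] <;> exact h _ (by decide)
    rw [hv]
    simp only [map_add, map_smul, LinearMap.add_apply, LinearMap.smul_apply, BL,
      Matrix.toBilin'_single]
    simp [LGram]
    ring
  rw [this]; positivity

lemma finrank_le (S : Submodule ℤ (Fin 24 → ℤ)) (hS : ∀ v ∈ S, v ≠ 0 → BL v v < 0) :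
    Module.finrank ℤ S ≤ 21 := by
  let pr : Fin 24 → ((Fin 24 → ℤ) →ₗ[ℤ] ℤ) := fun j => LinearMap.proj j
  let φ : (Fin 24 → ℤ) →ₗ[ℤ] (Fin 21 → ℤ) :=
    LinearMap.pi (fun i : Fin 21 =>
      if i = 0 then pr 0 - pr 1
      else if i = 1 then pr 2 - pr 3
      else if i = 2 then pr 4 - pr 5
      else pr ⟨i + 3, by omega⟩)
  have hinj : Function.Injective (φ ∘ₗ S.subtype) := by
    rw [← LinearMap.ker_eq_bot, LinearMap.ker_eq_bot']
    rintro ⟨v, hv⟩ h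
    have h' : φ v = 0 := h
    by_contra hne
    have hv0 : v ≠ 0 := fun h => hne (by ext1; exact h)
    have := hS v hv hv0
    have := BL_pos v (by simpa [φ, pr, sub_eq_zero] using congr_fun h' 0)
      (by simpa [φ, pr, sub_eq_zero] using congr_fun h' 1)
      (by simpa [φ, pr, sub_eq_zero] using congr_fun h' 2) (by
        intro i hi
        have hi' : 6 ≤ i.val := hi
        have e := congr_fun h' ⟨i.val - 3, by omega⟩
        have e0 : (⟨i.val - 3, by omega⟩ : Fin 21) ≠ 0 := by
          intro h; have := congrArg Fin.val h; simp at this; omega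
        have e1 : (⟨i.val - 3, by omega⟩ : Fin 21) ≠ 1 := by
          intro h; have := congrArg Fin.val h; simp at this; omega
        have e2 : (⟨i.val - 3, by omega⟩ : Fin 21) ≠ 2 := by
          intro h; have := congrArg Fin.val h; simp at this; omega
        simp only [φ, LinearMap.pi_apply, if_neg e0, if_neg e1, if_neg e2] at e
        have e3 : (⟨i.val - 3 + 3, by omega⟩ : Fin 24) = i := by ext; simp; omega
        simp only [pr, LinearMap.proj_apply] at e
        rw [e3] at e
        exact e)
    omega
  have := LinearMap.finrank_le_finrank_of_injective hinj
  simpa using this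

/-- The functional form of trivial action on the discriminant. -/
lemma exists_dual (h : (Fin 24 → ℤ) ≃ₗ[ℤ] (Fin 24 → ℤ)) (hiso : IsIsometry h)
    (htriv : ActsTriviallyOnDisc h) (φ : (Fin 24 → ℤ) →ₗ[ℤ] ℤ) :
    ∃ n : Fin 24 → ℤ, ∀ w, BL n (h w) = φ (w - h w) := by
  have hQdet : QGram.det = -3 := by
    have := RingHom.map_det (Int.castRingHom ℚ) LGram
    rw [LGram_det] at this
    simpa [QGram] using this.symm
  have hQu : IsUnit QGram.det := by rw [hQdet]; norm_num
  let u : Fin 24 → ℚ := fun k => φ (Pi.single k 1)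
  have hu : ∀ w, u ⬝ᵥ intVec w = φ w := by
    intro w
    have : w = ∑ k, w k • (Pi.single k 1 : Fin 24 → ℤ) := by
      ext j; simp [Finset.sum_apply, Pi.single_apply]
    conv_rhs => rw [this]
    rw [map_sum]
    simp only [map_smul, u, dotProduct, intVec, smul_eq_mul, Int.cast_sum, Int.cast_mul]
    exact Finset.sum_congr rfl fun i _ => mul_comm _ _
  let x : Fin 24 → ℚ := u ᵥ* QGram⁻¹
  have hx : ∀ y, Bq x y = u ⬝ᵥ y := by
    intro y
    rw [Bq, Matrix.dotProduct_mulVec, Matrix.vecMul_vecMul, Matrix.nonsing_inv_mul _ hQu,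
      Matrix.vecMul_one]
  have hdual : InDual x := by
    intro w
    exact ⟨φ w, by rw [hx, hu]⟩
  choose n hn using htriv x hdual
  have hBq : ∀ v w, Bq (intVec v) (intVec w) = (BL v w : ℚ) := by
    intro v w
    rw [← Bf_eq]
    simp [Bq, Bf, QGram, intVec, dotProduct, mulVec]
  have hgq : ∀ w, gQ h *ᵥ intVec w = intVec (h w) := by
    intro w
    have e : LinearMap.toMatrix' h.toLinearMap *ᵥ w = h w := by
      rw [LinearMap.toMatrix'_mulVec]; rfl
    ext i
    have e' := congr_fun e i
    simp only [intVec, gQ]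
    rw [← e']
    simp [mulVec, dotProduct, intVec]
  have hgi : (gQ h)ᵀ * QGram * gQ h = QGram := by
    have e : (LinearMap.toMatrix' h.toLinearMap)ᵀ * LGram * (LinearMap.toMatrix' h.toLinearMap)
        = LGram := by
      ext i j
      have e := hiso (Pi.single i 1) (Pi.single j 1)
      rw [Bf_eq, Bf_eq, BL, Matrix.toBilin'_single] at e
      rw [← e, Matrix.toBilin'_apply', Matrix.mul_assoc, Matrix.mul_apply']
      have e1 : h (Pi.single i 1) = (LinearMap.toMatrix' h.toLinearMap).col i := by
        ext k; simp [LinearMap.toMatrix'_apply]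
      have e2 : h (Pi.single j 1) = (LinearMap.toMatrix' h.toLinearMap).col j := by
        ext k; simp [LinearMap.toMatrix'_apply]
      rw [e1, e2]
      rfl
    have := congrArg (fun M : Matrix (Fin 24) (Fin 24) ℤ => M.map (Int.castRingHom ℚ)) e
    simp only [Matrix.map_mul] at this
    exact this
  refine ⟨n, fun w => ?_⟩
  have hn' : intVec n = gQ h *ᵥ x - x := by
    ext i; rw [hn i]; rfl
  have : ((BL n (h w) : ℤ) : ℚ) = ((φ (w - h w) : ℤ) : ℚ) := by
    rw [← hBq, hn']
    have e1 : Bq (gQ h *ᵥ x - x) (intVec (h w))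
        = Bq (gQ h *ᵥ x) (intVec (h w)) - Bq x (intVec (h w)) := by
      simp [Bq, sub_dotProduct]
    have e2 : Bq (gQ h *ᵥ x) (intVec (h w)) = Bq x (intVec w) := by
      rw [← hgq, Bq, Bq]
      conv_rhs => rw [← hgi]
      rw [← Matrix.vecMul_transpose, ← Matrix.dotProduct_mulVec, Matrix.mulVec_mulVec,
        Matrix.mulVec_mulVec]
    rw [e1, e2, hx, hx, hu, hu, map_sub]
    push_cast; ring
  exact_mod_cast this

section core

lemma mem_coinvL (h : (Fin 24 → ℤ) ≃ₗ[ℤ] (Fin 24 → ℤ)) (v : Fin 24 → ℤ) : v ∈ coinvL h ↔ ∀ w, h w = w → BL v w = 0 := by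
  constructor
  · intro hv w hw
    rw [← Bf_eq]; exact hv w hw
  · intro hv w hw
    rw [Bf_eq]; exact hv w hw

lemma BL_iso (h : (Fin 24 → ℤ) ≃ₗ[ℤ] (Fin 24 → ℤ)) (hiso : IsIsometry h)
    (v w : Fin 24 → ℤ) : BL (h v) (h w) = BL v w := by
  rw [← Bf_eq, ← Bf_eq]; exact hiso v w

lemma BL_pow (h : (Fin 24 → ℤ) ≃ₗ[ℤ] (Fin 24 → ℤ)) (hiso : IsIsometry h)
    (i : ℕ) (v w : Fin 24 → ℤ) (hw : h w = w) : BL ((h ^ i) v) w = BL v w := by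
  induction i with
  | zero => simp
  | succ i ih =>
    rw [pow_succ', LinearEquiv.mul_apply, ← ih]
    conv_lhs => rw [← hw]
    exact BL_iso h hiso _ _

lemma coinv_map (h : (Fin 24 → ℤ) ≃ₗ[ℤ] (Fin 24 → ℤ)) (hiso : IsIsometry h)
    (v : Fin 24 → ℤ) (hv : v ∈ coinvL h) : h v ∈ coinvL h := by
  rw [mem_coinvL] at *
  intro w hw
  rw [← hv w hw]
  conv_lhs => rw [← hw]
  exact BL_iso h hiso _ _

lemma trace_inv (h : (Fin 24 → ℤ) ≃ₗ[ℤ] (Fin 24 → ℤ)) (p : ℕ) (hp : h ^ p = 1) (v : Fin 24 → ℤ) :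
    h (∑ i ∈ Finset.range p, (h ^ i) v) = ∑ i ∈ Finset.range p, (h ^ i) v := by
  rw [map_sum]
  have e : ∀ i, h ((h ^ i) v) = (h ^ (i + 1)) v := by
    intro i; rw [pow_succ', LinearEquiv.mul_apply]
  simp only [e]
  have h1 := Finset.sum_range_succ (fun i => (h ^ i) v) p
  have h2 := Finset.sum_range_succ' (fun i => (h ^ i) v) p
  rw [h1] at h2
  rw [hp, pow_zero] at h2
  exact (add_right_cancel h2).symm

lemma gram_det {r k : ℕ} (c : Module.Basis (Fin r ⊕ Fin k) ℤ (Fin 24 → ℤ)) :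
    (Matrix.of fun a b => BL (c a) (c b)).det = -3 := by
  have hcard : Fintype.card (Fin r ⊕ Fin k) = Fintype.card (Fin 24) := by
    rw [← Module.finrank_eq_card_basis c, Module.finrank_fintype_fun_eq_card]
  let e : (Fin r ⊕ Fin k) ≃ Fin 24 := Fintype.equivOfCardEq hcard
  let c' := c.reindex e
  have h1 : (Matrix.of fun a b => BL (c a) (c b)).det = (Matrix.of fun a b => BL (c' a) (c' b)).det := by
    rw [← Matrix.det_submatrix_equiv_self e]
    congr 1
    ext a b
    simp [c']
  have h2 : (Matrix.of fun a b => BL (c' a) (c' b))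
      = ((Pi.basisFun ℤ (Fin 24)).toMatrix c')ᵀ * LGram * ((Pi.basisFun ℤ (Fin 24)).toMatrix c') := by
    ext a b
    rw [Matrix.of_apply, BL, Matrix.toBilin'_apply', Matrix.mul_assoc, Matrix.mul_apply']
    rfl
  have h3 : IsUnit ((Pi.basisFun ℤ (Fin 24)).toMatrix c').det := by
    have := Module.Basis.isUnit_det (Pi.basisFun ℤ (Fin 24)) c'
    rwa [Module.Basis.det_apply] at this
  rw [h1, h2, Matrix.det_mul, Matrix.det_mul, Matrix.det_transpose, LGram_det]
  have := Int.isUnit_mul_self h3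
  linear_combination (-3) * this

lemma core (h : (Fin 24 → ℤ) ≃ₗ[ℤ] (Fin 24 → ℤ)) (hiso : IsIsometry h)
    (p : ℕ) (hp : p.Prime) (hpow : h ^ p = 1) (hne : h ≠ 1)
    (htriv : ActsTriviallyOnDisc h)
    (hmin : ∀ v ∈ coinvL h, v ≠ 0 → BL v v ≤ -6) : False := by
  set S := coinvL h with hS
  have hneg : ∀ v ∈ S, v ≠ 0 → BL v v < 0 := fun v hv h0 => by have := hmin v hv h0; omega
  have hr21 := finrank_le S hneg
  set r := Module.finrank ℤ S with hr
  have hr0 : 0 < r := by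
    obtain ⟨v, hv⟩ : ∃ v, h v ≠ v := by
      by_contra hc
      push Not at hc
      exact hne (by ext1 v; exact hc v)
    have hm : h v - v ∈ S := by
      rw [mem_coinvL]
      intro w hw
      rw [map_sub, LinearMap.sub_apply, sub_eq_zero]
      conv_lhs => rw [← hw]
      exact BL_iso h hiso _ _
    have : Nontrivial S := ⟨⟨⟨_, hm⟩, 0, fun h => hv (sub_eq_zero.1 (congrArg Subtype.val h))⟩⟩
    exact Module.finrank_pos
  let b : Module.Basis (Fin r) ℤ S := Module.finBasis ℤ S
  have htf : Module.IsTorsionFree ℤ ((Fin 24 → ℤ) ⧸ S) := by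
    refine Module.IsTorsionFree.of_smul_eq_zero fun n q hq => ?_
    obtain ⟨v, rfl⟩ := Submodule.Quotient.mk_surjective S q
    rw [← Submodule.Quotient.mk_smul, Submodule.Quotient.mk_eq_zero, mem_coinvL] at hq
    rcases eq_or_ne n 0 with hn | hn
    · exact Or.inl hn
    · right
      rw [Submodule.Quotient.mk_eq_zero, mem_coinvL]
      intro w hw
      have := hq w hw
      rw [map_smul, LinearMap.smul_apply, smul_eq_mul] at this
      exact (mul_eq_zero.1 this).resolve_left hn
  let k := Module.finrank ℤ ((Fin 24 → ℤ) ⧸ S)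
  let bQ : Module.Basis (Fin k) ℤ ((Fin 24 → ℤ) ⧸ S) := Module.finBasis ℤ _
  let c : Module.Basis (Fin r ⊕ Fin k) ℤ (Fin 24 → ℤ) := b.sumQuot bQ
  have hc : ∀ i, c (Sum.inl i) = b i := fun i => Module.Basis.sumQuot_inl b bQ i
  have hk : k = 24 - r := by
    have := Module.finrank_eq_card_basis c
    simp at this
    omega
  -- Gram matrix
  let G : Matrix (Fin r) (Fin r) ℤ := Matrix.of fun i j => - BL (b i) (b j)
  have hGs : Gᵀ = G := by
    ext i j
    simp [G, BL_symm (b i) (b j)]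
  have hGmin : ∀ z : Fin r → ℤ, z ≠ 0 → 6 ≤ z ⬝ᵥ (G *ᵥ z) := by
    intro z hz
    have h1 : (∑ i, z i • b i) ≠ 0 := by
      intro h0
      apply hz
      ext i
      exact Fintype.linearIndependent_iff.1 b.linearIndependent z h0 i
    have h2 := hmin _ (∑ i, z i • b i).2 (fun h => h1 (Subtype.ext h))
    have h3 : z ⬝ᵥ (G *ᵥ z) = - BL ((∑ i, z i • b i : S) : Fin 24 → ℤ) ((∑ i, z i • b i : S) : Fin 24 → ℤ) := by
      simp only [Submodule.coe_sum, Submodule.coe_smul, map_sum, LinearMap.sum_apply, map_smul,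
        LinearMap.smul_apply, dotProduct, mulVec, G, Matrix.of_apply, smul_eq_mul, Finset.mul_sum]
      rw [← Finset.sum_neg_distrib, Finset.sum_comm]
      refine Finset.sum_congr rfl fun i _ => ?_
      rw [← Finset.sum_neg_distrib]
      refine Finset.sum_congr rfl fun j _ => ?_
      ring
    rw [h3]; omega
  obtain ⟨hD, hW⟩ := blichfeldt_int hr0 G hGs hGmin
  -- the restriction of h to S
  let f : Module.End ℤ S := (h.toLinearMap).restrict (fun v hv => coinv_map h hiso v hv)
  have hfc : ∀ s : S, ((f s : S) : Fin 24 → ℤ) = h s := fun s => rfl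
  have hfpow : ∀ (i : ℕ) (s : S), (((f ^ i) s : S) : Fin 24 → ℤ) = (h ^ i) s := by
    intro i s
    induction i with
    | zero => simp
    | succ i ih =>
      rw [pow_succ', pow_succ', LinearEquiv.mul_apply, ← ih]; rfl
  have hfsum : ∑ i ∈ Finset.range p, f ^ i = 0 := by
    ext1 s
    rw [LinearMap.sum_apply]
    have hinv := trace_inv h p hpow s
    have hcoe : ((∑ i ∈ Finset.range p, (f ^ i) s : S) : Fin 24 → ℤ)
        = ∑ i ∈ Finset.range p, (h ^ i) s := by
      rw [Submodule.coe_sum]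
      exact Finset.sum_congr rfl fun i _ => hfpow i s
    set t := ∑ i ∈ Finset.range p, (f ^ i) s with ht
    by_contra ht0
    rw [← hcoe] at hinv
    have h1 := (mem_coinvL h _).1 t.2 _ hinv
    have h2 := hneg _ t.2 (fun h => ht0 (Subtype.ext h))
    omega
  have hdetf := det_one_sub p hp f hfsum
  -- first bound
  have hdvd1 : G.det ∣ LinearMap.det (1 - f) := by
    choose n hn using fun i : Fin r => exists_dual h hiso htriv (c.coord (Sum.inl i))
    have hnS : ∀ i, n i ∈ S := by
      intro i
      rw [mem_coinvL]
      intro w hw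
      have := hn i w
      rw [hw] at this
      simpa using this
    let N : Matrix (Fin r) (Fin r) ℤ := Matrix.of fun i j => b.repr ⟨n i, hnS i⟩ j
    let A := LinearMap.toMatrix b b f
    have hmat : LinearMap.toMatrix b b (1 - f) = - (N * G * A) := by
      ext i l
      have h1 := hn i (b l)
      have h2 : c.coord (Sum.inl i) ((b l : Fin 24 → ℤ) - h (b l)) = LinearMap.toMatrix b b (1 - f) i l := by
        rw [LinearMap.toMatrix_apply]
        have : ((b l : Fin 24 → ℤ) - h (b l)) = (((1 - f) (b l) : S) : Fin 24 → ℤ) := by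
          simp [hfc]
        rw [this, Module.Basis.coord_apply]
        exact Module.Basis.sumQuot_repr_inl b bQ _ i
      rw [← h2, ← h1]
      have h3 : n i = ∑ j, N i j • (b j : Fin 24 → ℤ) := by
        have := congrArg Subtype.val (b.sum_repr ⟨n i, hnS i⟩)
        rw [Submodule.coe_sum] at this
        exact this.symm
      have h4 : h (b l) = ∑ j, A j l • (b j : Fin 24 → ℤ) := by
        have := congrArg Subtype.val (b.sum_repr (f (b l)))
        rw [Submodule.coe_sum] at this
        rw [hfc] at this
        rw [← this]
        refine Finset.sum_congr rfl fun j _ => ?_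
        simp [A, LinearMap.toMatrix_apply]
      rw [h3, h4]
      simp only [map_sum, LinearMap.sum_apply, map_smul, LinearMap.smul_apply, smul_eq_mul,
        Matrix.neg_apply, Matrix.mul_apply, G, Matrix.of_apply, Finset.sum_mul]
      rw [← Finset.sum_neg_distrib]
      refine Finset.sum_congr rfl fun j _ => ?_
      rw [← Finset.sum_neg_distrib, Finset.mul_sum]
      refine Finset.sum_congr rfl fun j' _ => ?_
      ring
    rw [← LinearMap.det_toMatrix b, hmat, Matrix.det_neg, Matrix.det_mul, Matrix.det_mul]
    exact ⟨(-1) ^ Fintype.card (Fin r) * N.det * A.det, by ring⟩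
  have hb1 : G.det ^ (p-1) ≤ (p:ℤ) ^ r := by
    rw [← hdetf]
    have hne0 : LinearMap.det (1 - f) ≠ 0 := by
      intro h0
      rw [h0] at hdetf
      have : (0:ℤ) < (p:ℤ)^r := by have := hp.pos; positivity
      rw [abs_zero, zero_pow (by have := hp.two_le; omega)] at hdetf
      exact absurd hdetf (ne_of_lt this)
    refine pow_le_pow_left₀ hD.le ?_ _
    exact Int.le_of_dvd (abs_pos.2 hne0) ((dvd_abs _ _).2 hdvd1)
  -- second bound
  have hdvd2 : G.det ∣ 3 * (p:ℤ)^k := by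
    let t : Fin k → (Fin 24 → ℤ) := fun j => ∑ i ∈ Finset.range p, (h ^ i) (c (Sum.inr j))
    have ht : ∀ j, h (t j) = t j := fun j => trace_inv h p hpow _
    have hsS : ∀ j, (p:ℤ) • c (Sum.inr j) - t j ∈ S := by
      intro j
      rw [mem_coinvL]
      intro w hw
      simp only [t, map_sub, LinearMap.sub_apply, map_sum, LinearMap.sum_apply, map_smul,
        LinearMap.smul_apply, BL_pow h hiso _ _ w hw]
      simp
    let E : Matrix (Fin k) (Fin r) ℤ := Matrix.of fun j i => b.repr ⟨_, hsS j⟩ i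
    have hE : ∀ j, t j = (p:ℤ) • c (Sum.inr j) - ∑ i, E j i • (b i : Fin 24 → ℤ) := by
      intro j
      have := congrArg Subtype.val (b.sum_repr ⟨_, hsS j⟩)
      rw [Submodule.coe_sum] at this
      have h2 : ∑ i, E j i • (b i : Fin 24 → ℤ) = (p:ℤ) • c (Sum.inr j) - t j := this
      rw [h2]; abel
    let Q : Matrix (Fin r ⊕ Fin k) (Fin r ⊕ Fin k) ℤ := Matrix.of fun a b => BL (c a) (c b)
    let W : Matrix (Fin k) (Fin k) ℤ := Matrix.of fun i j => BL (t i) (c (Sum.inr j))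
    let B' : Matrix (Fin r) (Fin k) ℤ := Matrix.of fun i j => BL (b i) (c (Sum.inr j))
    have hmat : Matrix.fromBlocks (1 : Matrix (Fin r) (Fin r) ℤ) 0 (-E) ((p:ℤ) • 1) * Q
        = Matrix.fromBlocks (-G) B' 0 W := by
      have hQ : Q = Matrix.fromBlocks (-G) B' (Matrix.of fun i j => BL (c (Sum.inr i)) (b j))
          (Matrix.of fun i j => BL (c (Sum.inr i)) (c (Sum.inr j))) := by
        ext (i | i) (j | j) <;> simp [Q, G, B', hc]
      rw [hQ, Matrix.fromBlocks_multiply]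
      congr 1
      · simp
      · simp
      · ext i j
        have h1 : BL (t i) (b j) = 0 := by
          rw [BL_symm]
          exact (mem_coinvL h _).1 (b j).2 _ (ht i)
        rw [hE] at h1
        simp only [map_sub, LinearMap.sub_apply, map_sum, LinearMap.sum_apply, map_smul,
          LinearMap.smul_apply, smul_eq_mul] at h1
        simp only [Matrix.add_apply, Matrix.smul_mul, Matrix.one_mul, Matrix.smul_apply, Matrix.neg_mul,
          Matrix.neg_apply, Matrix.mul_apply, Matrix.of_apply, smul_eq_mul, G, B',
          mul_neg, Finset.sum_neg_distrib, neg_neg, Matrix.zero_apply]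
        linarith
      · ext i j
        simp only [W, Matrix.of_apply]
        rw [hE]
        simp only [map_sub, LinearMap.sub_apply, map_sum, LinearMap.sum_apply, map_smul,
          LinearMap.smul_apply, smul_eq_mul]
        simp only [Matrix.add_apply, Matrix.smul_mul, Matrix.one_mul, Matrix.smul_apply, Matrix.neg_mul,
          Matrix.neg_apply, Matrix.mul_apply, Matrix.of_apply, smul_eq_mul, G, B',
          mul_neg, Finset.sum_neg_distrib, neg_neg, Matrix.zero_apply]
        ring
    have hd := congrArg Matrix.det hmat
    rw [Matrix.det_mul, Matrix.det_fromBlocks_zero₁₂, Matrix.det_fromBlocks_zero₂₁,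
      gram_det c, Matrix.det_neg, Matrix.det_smul] at hd
    simp only [Matrix.det_one, Fintype.card_fin, mul_one, one_mul] at hd
    exact ⟨- (-1)^r * W.det, by linear_combination (-1) * hd⟩
  have hb2 : G.det ≤ 3 * (p:ℤ)^(24 - r) := by
    rw [← hk]
    exact Int.le_of_dvd (by have := hp.pos; positivity) hdvd2
  exact numeric r p hp G.det hD hr0 hr21 hb1 hb2 hW

end core

lemma pow_isometry (g : (Fin 24 → ℤ) ≃ₗ[ℤ] (Fin 24 → ℤ)) (hiso : IsIsometry g) (m : ℕ) :
    IsIsometry (g ^ m) := by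
  induction m with
  | zero => intro v w; rfl
  | succ m ih =>
    intro v w
    rw [pow_succ', LinearEquiv.mul_apply, LinearEquiv.mul_apply, hiso, ih]

lemma pow_triv (g : (Fin 24 → ℤ) ≃ₗ[ℤ] (Fin 24 → ℤ)) (htriv : ActsTriviallyOnDisc g) 
    (hiso : IsIsometry g) (m : ℕ) :
    ActsTriviallyOnDisc (g ^ m) := by
  have hgq : ∀ w, gQ g *ᵥ intVec w = intVec (g w) := by
    intro w
    have e : LinearMap.toMatrix' g.toLinearMap *ᵥ w = g w := by
      rw [LinearMap.toMatrix'_mulVec]; rfl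
    ext i
    have e1 := congr_fun e i
    simp only [intVec, gQ]
    rw [← e1]
    simp [mulVec, dotProduct, intVec]
  have hmul : ∀ m : ℕ, gQ (g ^ (m + 1)) = gQ g * gQ (g ^ m) := by
    intro m
    have e : LinearMap.toMatrix' (g ^ (m + 1)).toLinearMap
        = LinearMap.toMatrix' g.toLinearMap * LinearMap.toMatrix' (g ^ m).toLinearMap := by
      rw [← LinearMap.toMatrix'_mul, pow_succ']
      rfl
    have := congrArg (fun M : Matrix (Fin 24) (Fin 24) ℤ => M.map (Int.castRingHom ℚ)) e
    simp only [Matrix.map_mul] at this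
    exact this
  have key : ∀ x, InDual x → ∃ n : Fin 24 → ℤ, intVec n = gQ (g ^ m) *ᵥ x - x := by
    intro x hx
    choose n1 hn1 using htriv x hx
    have hn1' : intVec n1 = gQ g *ᵥ x - x := by
      ext i; rw [hn1 i]; rfl
    induction m with
    | zero =>
      refine ⟨0, ?_⟩
      have e : gQ (g ^ 0) = 1 := by
        have e : LinearMap.toMatrix' (g ^ 0).toLinearMap = 1 := LinearMap.toMatrix'_one
        have := congrArg (fun M : Matrix (Fin 24) (Fin 24) ℤ => M.map (Int.castRingHom ℚ)) e
        simp only [Matrix.map_one _ (map_zero (Int.castRingHom ℚ)) (map_one (Int.castRingHom ℚ))] at this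
        exact this
      rw [e, Matrix.one_mulVec, sub_self]
      ext i; simp [intVec]
    | succ m ih =>
      obtain ⟨n, hn⟩ := ih
      refine ⟨g n + n1, ?_⟩
      have e : intVec (g n + n1) = intVec (g n) + intVec n1 := by
        ext i; simp [intVec]
      rw [e, ← hgq, hn, hn1', hmul, Matrix.mulVec_sub, Matrix.mulVec_mulVec]
      abel
  intro x hx
  obtain ⟨n, hn⟩ := key x hx
  intro i
  exact ⟨n i, (congr_fun hn i).symm⟩

/-- Any isometry of finite order of `𝐋 = 3U ⊕ 2E8 ⊕ A2` acting trivially on the discriminant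
group `𝐋^♯`, whose coinvariant sublattice is negative definite and contains no vector of
square `-2` and no vector of square `-4`, is the identity. -/
theorem stmt1 (g : (Fin 24 → ℤ) ≃ₗ[ℤ] (Fin 24 → ℤ)) (hiso : IsIsometry g)
    (hfin : IsOfFinOrder g)
    (htriv : ActsTriviallyOnDisc g)
    (hneg : ∀ v ∈ coinvL g, v ≠ 0 → Bf v v < 0)
    (h2 : ∀ v ∈ coinvL g, Bf v v ≠ -2)
    (h4 : ∀ v ∈ coinvL g, Bf v v ≠ -4) :
    g = 1 := by
  by_contra hg
  have hn : orderOf g ≠ 1 := fun h => hg (orderOf_eq_one_iff.1 h)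
  obtain ⟨p, hp, m, hm⟩ := Nat.exists_prime_and_dvd hn
  have hpos : 0 < orderOf g := hfin.orderOf_pos
  have hm0 : 0 < m := by
    rcases Nat.eq_zero_or_pos m with rfl | h
    · rw [mul_zero] at hm; omega
    · exact h
  refine core (g ^ m) (pow_isometry g hiso m) p hp ?_ ?_ (pow_triv g htriv hiso m) ?_
  · rw [← pow_mul, mul_comm, ← hm, pow_orderOf_eq_one]
  · intro h1
    have := Nat.le_of_dvd hm0 (orderOf_dvd_of_pow_eq_one h1)
    have := hp.two_le
    nlinarith
  · intro v hv hv0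
    have hv' : v ∈ coinvL g := by
      rw [mem_coinvL] at *
      intro w hw
      apply hv
      have : ∀ m : ℕ, (g ^ m) w = w := by
        intro m
        induction m with
        | zero => rfl
        | succ m ih => rw [pow_succ', LinearEquiv.mul_apply, ih, hw]
      exact this m
    have e1 := hneg v hv' hv0
    have e2 := h2 v hv'
    have e3 := h4 v hv'
    rw [Bf_eq] at e1 e2 e3
    obtain ⟨q, hq⟩ := BL_even v
    omega
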